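/- arXiv:2211.04827 — 6 statements merged into one kernel-verified Lean document; each statement's English description precedes it below -/
import Mathlib

section
/- Suppose sequences (x_k), (γ_k), (α_k), (p_k), (Φ_k) are generated by the nonmonotone proximal gradient method. Then for every k ≥ 1 one has φ(x_k) + (1 − p_k)·δ_k ≤ Φ_k ≤ Φ_{k−1} − p_k·δ_k, where δ_k := ((1 − α_k)/(2γ_k))·‖x_k − x_{k−1}‖². In particular, the sequence (Φ_k) is monotonically nonincreasing and Φ_k ≥ inf φ for all k ≥ 0. -/
open Filter Topology
open scoped RealInnerProductSpace

variable {X : Type*} [NormedAddCommGroup X] [InnerProductSpace ℝ X] [FiniteDimensional ℝ X]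

/-- The extended-real-valued composite objective `φ = f + g`. -/
noncomputable def phiE (f : X → ℝ) (g : X → EReal) (z : X) : EReal :=
  (f z : EReal) + g z

/-- `y` minimizes `z ↦ g z + ⟪v, z - x⟫ + ‖z - x‖² / (2γ)` over `X`
(a proximal gradient step from `x` with gradient vector `v` and stepsize `γ`). -/
def ProxMin (g : X → EReal) (v x : X) (γ : ℝ) (y : X) : Prop :=
  ∀ z : X,
    g y + ((⟪v, y - x⟫ + ‖y - x‖ ^ 2 / (2 * γ) : ℝ) : EReal) ≤
      g z + ((⟪v, z - x⟫ + ‖z - x‖ ^ 2 / (2 * γ) : ℝ) : EReal)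

/-- Fréchet (regular) subgradient of `h` at `xb`. -/
noncomputable def FSubgrad (h : X → EReal) (xb v : X) : Prop :=
  h xb ≠ ⊤ ∧
    0 ≤ Filter.liminf
        (fun z : X => (h z - h xb - ((⟪v, z - xb⟫ : ℝ) : EReal)) / ((‖z - xb‖ : ℝ) : EReal))
        (𝓝[≠] xb)

/-- Limiting (Mordukhovich) subgradient of `h` at `xb`. -/
noncomputable def MSubgrad (h : X → EReal) (xb v : X) : Prop :=
  h xb ≠ ⊤ ∧
    ∃ xs vs : ℕ → X,
      Tendsto xs atTop (𝓝 xb) ∧ Tendsto vs atTop (𝓝 v) ∧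
        Tendsto (fun j => h (xs j)) atTop (𝓝 (h xb)) ∧ ∀ j, FSubgrad h (xs j) (vs j)

/-- The sequences `x, γ, α, p, Φ` are generated by the nonmonotone proximal gradient
method for `φ = f + g` with parameters `γmax, αmin, αmax, pmin`. -/
structure NMPG (f : X → ℝ) (g : X → EReal) (γmax αmin αmax pmin : ℝ)
    (x : ℕ → X) (γ α p : ℕ → ℝ) (Φ : ℕ → ℝ) : Prop where
  hf : ContDiff ℝ 1 f
  hg_nebot : ∀ z, g z ≠ ⊥
  hg_proper : ∃ z, g z ≠ ⊤
  hg_lsc : LowerSemicontinuous g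
  hg_proxbdd : ∃ γ₀ : ℝ, 0 < γ₀ ∧ ∃ m : ℝ, ∀ z,
    (m : EReal) ≤ g z + ((‖z‖ ^ 2 / (2 * γ₀) : ℝ) : EReal)
  hφ_bdd : ∃ m : ℝ, ∀ z, (m : EReal) ≤ phiE f g z
  hγmax : 0 < γmax
  hαmin : 0 < αmin
  hαα : αmin ≤ αmax
  hαmax : αmax < 1
  hpmin : 0 < pmin
  hpone : pmin ≤ 1
  hx0 : g (x 0) ≠ ⊤
  hΦ0 : (Φ 0 : EReal) = phiE f g (x 0)
  hγpos : ∀ k, 0 < γ k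
  hγle : ∀ k, γ k ≤ γmax
  hαmem : ∀ k, α k ∈ Set.Icc αmin αmax
  hpmem : ∀ k, p k ∈ Set.Icc pmin 1
  hstep : ∀ k : ℕ, ProxMin g (gradient f (x k)) (x k) (γ (k + 1)) (x (k + 1))
  hls : ∀ k : ℕ, phiE f g (x (k + 1)) ≤
      ((Φ k - (1 - α (k + 1)) / (2 * γ (k + 1)) * ‖x (k + 1) - x k‖ ^ 2 : ℝ) : EReal)
  hΦrec : ∀ k : ℕ, Φ (k + 1) = (1 - p (k + 1)) * Φ k + p (k + 1) * (phiE f g (x (k + 1))).toReal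

/-- Backtracking information: for every `k`, either `γ k ≥ γmin`, or the previously
attempted stepsize `σ ∈ [γ k / βmax, γ k / βmin]` was rejected by the line search. -/
def Backtrack (f : X → ℝ) (g : X → EReal) (αmin γmin βmin βmax : ℝ)
    (x : ℕ → X) (γ : ℕ → ℝ) (Φ : ℕ → ℝ) : Prop :=
  ∀ k : ℕ, γmin ≤ γ (k + 1) ∨
    ∃ σ : ℝ, ∃ y : X, γ (k + 1) / βmax ≤ σ ∧ σ ≤ γ (k + 1) / βmin ∧
      ProxMin g (gradient f (x k)) (x k) σ y ∧
      ((Φ k - (1 - αmin) / (2 * σ) * ‖y - x k‖ ^ 2 : ℝ) : EReal) < phiE f g y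

lemma NMPG.exists_coe_eq_phiE {f : X → ℝ} {g : X → EReal} {γmax αmin αmax pmin : ℝ}
    {x : ℕ → X} {γ α p : ℕ → ℝ} {Φ : ℕ → ℝ}
    (h : NMPG f g γmax αmin αmax pmin x γ α p Φ) (k : ℕ) :
    ∃ r : ℝ, (r : EReal) = phiE f g (x (k + 1)) := by
  obtain ⟨m, hm⟩ := h.hφ_bdd
  exact ⟨_, EReal.coe_toReal (ne_top_of_le_ne_top (EReal.coe_ne_top _) (h.hls k))
    (ne_bot_of_le_ne_bot (EReal.coe_ne_bot m) (hm _))⟩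

theorem stmt_0 (f : X → ℝ) (g : X → EReal) (γmax αmin αmax pmin : ℝ)
    (x : ℕ → X) (γ α p : ℕ → ℝ) (Φ : ℕ → ℝ)
    (h : NMPG f g γmax αmin αmax pmin x γ α p Φ) :
    (∀ k : ℕ,
        phiE f g (x (k + 1)) +
            (((1 - p (k + 1)) *
                ((1 - α (k + 1)) / (2 * γ (k + 1)) * ‖x (k + 1) - x k‖ ^ 2) : ℝ) : EReal)
          ≤ (Φ (k + 1) : EReal) ∧
        Φ (k + 1) ≤ Φ k - p (k + 1) * ((1 - α (k + 1)) / (2 * γ (k + 1)) * ‖x (k + 1) - x k‖ ^ 2)) ∧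
      Antitone Φ ∧ ∀ k : ℕ, (⨅ z : X, phiE f g z) ≤ (Φ k : EReal) := by
  have hδ : ∀ k, 0 ≤ (1 - α (k + 1)) / (2 * γ (k + 1)) * ‖x (k + 1) - x k‖ ^ 2 := fun k => by
    have h1 : 0 ≤ 1 - α (k + 1) := by linarith [(h.hαmem (k + 1)).2, h.hαmax]
    have h2 := h.hγpos (k + 1)
    positivity
  have hp : ∀ k, 0 ≤ p k ∧ 0 ≤ 1 - p k := fun k =>
    ⟨h.hpmin.le.trans (h.hpmem k).1, sub_nonneg.2 (h.hpmem k).2⟩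
  have key : ∀ k : ℕ,
      phiE f g (x (k + 1)) +
          (((1 - p (k + 1)) *
              ((1 - α (k + 1)) / (2 * γ (k + 1)) * ‖x (k + 1) - x k‖ ^ 2) : ℝ) : EReal)
        ≤ (Φ (k + 1) : EReal) ∧
      Φ (k + 1) ≤
        Φ k - p (k + 1) * ((1 - α (k + 1)) / (2 * γ (k + 1)) * ‖x (k + 1) - x k‖ ^ 2) := by
    intro k
    obtain ⟨r, hr⟩ := h.exists_coe_eq_phiE k
    have hls := h.hls k
    have hrec := h.hΦrec k
    rw [← hr, EReal.coe_le_coe_iff] at hls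
    rw [← hr, EReal.toReal_coe] at hrec
    rw [← hr, ← EReal.coe_add, EReal.coe_le_coe_iff, hrec]
    generalize (1 - α (k + 1)) / (2 * γ (k + 1)) * ‖x (k + 1) - x k‖ ^ 2 = δ at hls ⊢
    constructor
    · linarith [mul_le_mul_of_nonneg_left hls (hp (k + 1)).2]
    · linarith [mul_le_mul_of_nonneg_left hls (hp (k + 1)).1]
  refine ⟨key, antitone_nat_of_succ_le fun k => ?_, fun k => ?_⟩
  · exact (key k).2.trans (sub_le_self _ (mul_nonneg (hp _).1 (hδ k)))
  · cases k with
    | zero => exact h.hΦ0 ▸ iInf_le _ _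
    | succ k =>
      refine (iInf_le _ (x (k + 1))).trans (le_trans ?_ (key k).1)
      exact le_add_of_nonneg_right (EReal.coe_nonneg.2 (mul_nonneg (hp _).2 (hδ k)))
end

section
/- Suppose sequences (x_k), (γ_k), (α_k), (p_k), (Φ_k) are generated by the nonmonotone proximal gradient method. Then the sequence (Φ_k) converges from above to a finite limit φ_* with φ_* ≥ inf φ, and the sequence (φ(x_k)) converges to the same limit φ_*. -/
open Filter Topology
open scoped RealInnerProductSpace

variable {X : Type*} [NormedAddCommGroup X] [InnerProductSpace ℝ X] [FiniteDimensional ℝ X]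

/-- If the reference values `Φ` are obtained by averaging values `u` that lie below the previous
reference value, with weights bounded away from zero, then `Φ` decreases to a limit shared by `u`. -/
theorem tendsto_of_averaging {Φ u p : ℕ → ℝ} {pmin m : ℝ} (hpmin : 0 < pmin)
    (hp : ∀ k, p k ∈ Set.Icc pmin 1) (hm : ∀ k, m ≤ u k) (h0 : Φ 0 = u 0)
    (hle : ∀ k, u (k + 1) ≤ Φ k)
    (hrec : ∀ k, Φ (k + 1) = (1 - p (k + 1)) * Φ k + p (k + 1) * u (k + 1)) :
    ∃ l, Tendsto Φ atTop (𝓝 l) ∧ (∀ k, l ≤ Φ k) ∧ Tendsto u atTop (𝓝 l) := by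
  have hanti : Antitone Φ := antitone_nat_of_succ_le fun k => by
    have hpos : 0 < p (k + 1) := hpmin.trans_le (hp (k + 1)).1
    rw [hrec k]
    nlinarith [mul_nonneg hpos.le (sub_nonneg.2 (hle k))]
  have hbdd : BddBelow (Set.range Φ) :=
    ⟨m, Set.forall_mem_range.2 fun k => by
      cases k with
      | zero => exact h0 ▸ hm 0
      | succ k => exact (hm (k + 2)).trans (hle (k + 1))⟩
  have hlim : Tendsto Φ atTop (𝓝 (⨅ k, Φ k)) := tendsto_atTop_ciInf hanti hbdd
  refine ⟨_, hlim, ciInf_le hbdd, (tendsto_add_atTop_iff_nat 1).1 ?_⟩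
  have hlim_succ := (tendsto_add_atTop_iff_nat 1).2 hlim
  have hlower : Tendsto (fun k => Φ k - (Φ k - Φ (k + 1)) / pmin) atTop (𝓝 (⨅ k, Φ k)) := by
    simpa using hlim.sub ((hlim.sub hlim_succ).div_const pmin)
  refine tendsto_of_tendsto_of_tendsto_of_le_of_le hlower hlim (fun k => ?_) hle
  have hdiff : Φ k - Φ (k + 1) = p (k + 1) * (Φ k - u (k + 1)) := by
    rw [hrec k]
    ring
  have hgap : Φ k - u (k + 1) ≤ (Φ k - Φ (k + 1)) / pmin := by
    rw [le_div_iff₀ hpmin, hdiff, mul_comm]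
    exact mul_le_mul_of_nonneg_right (hp (k + 1)).1 (sub_nonneg.2 (hle k))
  dsimp only
  linarith

theorem stmt_2 (f : X → ℝ) (g : X → EReal) (γmax αmin αmax pmin : ℝ)
    (x : ℕ → X) (γ α p : ℕ → ℝ) (Φ : ℕ → ℝ)
    (h : NMPG f g γmax αmin αmax pmin x γ α p Φ) :
    ∃ φstar : ℝ, Tendsto Φ atTop (𝓝 φstar) ∧ (∀ k : ℕ, φstar ≤ Φ k) ∧
      (⨅ z : X, phiE f g z) ≤ (φstar : EReal) ∧
      Tendsto (fun k => phiE f g (x k)) atTop (𝓝 (φstar : EReal)) := by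
  obtain ⟨m, hm⟩ := h.hφ_bdd
  have hcoe : ∀ k, ((phiE f g (x k)).toReal : EReal) = phiE f g (x k) := fun k => by
    refine EReal.coe_toReal ?_ ((EReal.bot_lt_coe m).trans_le (hm _)).ne'
    cases k with
    | zero => exact h.hΦ0 ▸ EReal.coe_ne_top _
    | succ k => exact ((h.hls k).trans_lt (EReal.coe_lt_top _)).ne
  have hle : ∀ k, (phiE f g (x (k + 1))).toReal ≤ Φ k := fun k => by
    have hls := h.hls k
    rw [← hcoe, EReal.coe_le_coe_iff] at hls
    have hα : 0 ≤ 1 - α (k + 1) := sub_nonneg.2 ((h.hαmem (k + 1)).2.trans h.hαmax.le)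
    have hγ := h.hγpos (k + 1)
    have hdec : 0 ≤ (1 - α (k + 1)) / (2 * γ (k + 1)) * ‖x (k + 1) - x k‖ ^ 2 := by positivity
    linarith
  obtain ⟨l, hΦ, hlΦ, hu⟩ := tendsto_of_averaging (u := fun k => (phiE f g (x k)).toReal) h.hpmin
    h.hpmem (fun k => EReal.coe_le_coe_iff.1 ((hm (x k)).trans_eq (hcoe k).symm))
    (EReal.coe_injective (h.hΦ0.trans (hcoe 0).symm)) hle h.hΦrec
  have hφ : Tendsto (fun k => phiE f g (x k)) atTop (𝓝 (l : EReal)) :=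
    (EReal.tendsto_coe.2 hu).congr hcoe
  exact ⟨l, hΦ, hlΦ, ge_of_tendsto' hφ fun k => iInf_le _ (x k), hφ⟩
end

section
/- Suppose sequences (x_k), (γ_k), (α_k), (p_k), (Φ_k) are generated by the nonmonotone proximal gradient method. Then the series ∑_{k≥1} (1/γ_k)·‖x_k − x_{k−1}‖² converges (is finite); more precisely, for every k ≥ 1, ∑_{j=1}^{k} p_min·((1 − α_max)/(2γ_j))·‖x_j − x_{j−1}‖² ≤ φ(x_0) − φ_*, where φ_* denotes the (existing, finite) limit of the nonincreasing sequence (Φ_k). -/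
open Filter Topology
open scoped RealInnerProductSpace

variable {X : Type*} [NormedAddCommGroup X] [InnerProductSpace ℝ X] [FiniteDimensional ℝ X]

/-- A real upper bound on a composite value also bounds its real part. -/
lemma phiE_toReal_le {Y : Type*} {f : Y → ℝ} {g : Y → EReal} {z : Y} {c : ℝ}
    (hg : g z ≠ ⊥) (h : phiE f g z ≤ (c : EReal)) : (phiE f g z).toReal ≤ c := by
  have hbot : phiE f g z ≠ ⊥ := by simp [phiE, EReal.add_eq_bot_iff, hg]
  simpa using EReal.toReal_le_toReal h hbot (EReal.coe_ne_top c)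

/-- The sufficient decrease of the merit values `Φ`. -/
lemma NMPG.decrease {f : X → ℝ} {g : X → EReal} {γmax αmin αmax pmin : ℝ}
    {x : ℕ → X} {γ α p Φ : ℕ → ℝ} (h : NMPG f g γmax αmin αmax pmin x γ α p Φ) (j : ℕ) :
    pmin * ((1 - αmax) / (2 * γ (j + 1))) * ‖x (j + 1) - x j‖ ^ 2 ≤ Φ j - Φ (j + 1) := by
  have hφ := phiE_toReal_le (h.hg_nebot _) (h.hls j)
  have hγ := h.hγpos (j + 1)
  have hα := (h.hαmem (j + 1)).2
  have hp := (h.hpmem (j + 1)).1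
  have hp0 : 0 ≤ p (j + 1) := h.hpmin.le.trans hp
  have h1 : 0 ≤ 1 - αmax := by linarith [h.hαmax]
  calc pmin * ((1 - αmax) / (2 * γ (j + 1))) * ‖x (j + 1) - x j‖ ^ 2
      ≤ p (j + 1) * ((1 - α (j + 1)) / (2 * γ (j + 1))) * ‖x (j + 1) - x j‖ ^ 2 := by gcongr
    _ = p (j + 1) * ((1 - α (j + 1)) / (2 * γ (j + 1)) * ‖x (j + 1) - x j‖ ^ 2) := by ring
    _ ≤ p (j + 1) * (Φ j - (phiE f g (x (j + 1))).toReal) := by gcongr; linarith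
    _ = Φ j - Φ (j + 1) := by rw [h.hΦrec j]; ring

/-- The initial merit value is the objective at the starting point. -/
lemma NMPG.merit_zero {f : X → ℝ} {g : X → EReal} {γmax αmin αmax pmin : ℝ}
    {x : ℕ → X} {γ α p Φ : ℕ → ℝ} (h : NMPG f g γmax αmin αmax pmin x γ α p Φ) :
    Φ 0 = f (x 0) + (g (x 0)).toReal := by
  have h0 := h.hΦ0
  rw [phiE, ← EReal.coe_toReal h.hx0 (h.hg_nebot _)] at h0
  exact_mod_cast h0

theorem stmt_3 (f : X → ℝ) (g : X → EReal) (γmax αmin αmax pmin : ℝ)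
    (x : ℕ → X) (γ α p : ℕ → ℝ) (Φ : ℕ → ℝ)
    (h : NMPG f g γmax αmin αmax pmin x γ α p Φ)
    (φstar : ℝ) (hΦlim : Tendsto Φ atTop (𝓝 φstar)) :
    Summable (fun k : ℕ => 1 / γ (k + 1) * ‖x (k + 1) - x k‖ ^ 2) ∧
      ∀ k : ℕ, 1 ≤ k →
        ∑ j ∈ Finset.range k, pmin * ((1 - αmax) / (2 * γ (j + 1))) * ‖x (j + 1) - x j‖ ^ 2
          ≤ f (x 0) + (g (x 0)).toReal - φstar := by
  have hterm (j : ℕ) :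
      0 ≤ pmin * ((1 - αmax) / (2 * γ (j + 1))) * ‖x (j + 1) - x j‖ ^ 2 := by
    have hγ := h.hγpos (j + 1)
    have hα : 0 ≤ 1 - αmax := by linarith [h.hαmax]
    have hp := h.hpmin
    positivity
  have hanti : Antitone Φ :=
    antitone_nat_of_succ_le fun j => by linarith [hterm j, h.decrease j]
  have hsum (k : ℕ) :
      ∑ j ∈ Finset.range k, pmin * ((1 - αmax) / (2 * γ (j + 1))) * ‖x (j + 1) - x j‖ ^ 2
        ≤ f (x 0) + (g (x 0)).toReal - φstar := by
    rw [← h.merit_zero]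
    calc _ ≤ ∑ j ∈ Finset.range k, (Φ j - Φ (j + 1)) :=
          Finset.sum_le_sum fun j _ => h.decrease j
      _ = Φ 0 - Φ k := Finset.sum_range_sub' Φ k
      _ ≤ Φ 0 - φstar := by linarith [hanti.le_of_tendsto hΦlim k]
  refine ⟨?_, fun k _ => hsum k⟩
  have hα : 1 - αmax ≠ 0 := (sub_pos.2 h.hαmax).ne'
  refine ((summable_of_sum_range_le hterm hsum).mul_left (2 / (pmin * (1 - αmax)))).congr
    fun j => ?_
  have hγ := (h.hγpos (j + 1)).ne'
  have hp := h.hpmin.ne'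
  field_simp
end

section
/- Suppose sequences (x_k), (γ_k), (α_k), (p_k), (Φ_k) are generated by the nonmonotone proximal gradient method. Then ‖x_k − x_{k−1}‖ → 0 as k → ∞. -/
open Filter Topology
open scoped RealInnerProductSpace

variable {X : Type*} [NormedAddCommGroup X] [InnerProductSpace ℝ X] [FiniteDimensional ℝ X]

/-- In a nonmonotone proximal gradient run, the line search gives real-valued objective values:
they are bounded below by any lower bound of `φ`, and satisfy the sufficient decrease with the
uniform constant `(1 - αmax) / (2 * γmax)`. -/
lemma NMPG.toReal_bounds {f : X → ℝ} {g : X → EReal} {γmax αmin αmax pmin : ℝ}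
    {x : ℕ → X} {γ α p : ℕ → ℝ} {Φ : ℕ → ℝ}
    (h : NMPG f g γmax αmin αmax pmin x γ α p Φ) {m : ℝ}
    (hm : ∀ z, (m : EReal) ≤ phiE f g z) (k : ℕ) :
    m ≤ (phiE f g (x (k + 1))).toReal ∧
      (phiE f g (x (k + 1))).toReal ≤
        Φ k - (1 - αmax) / (2 * γmax) * ‖x (k + 1) - x k‖ ^ 2 := by
  have hls := h.hls k
  have hlow := hm (x (k + 1))
  lift phiE f g (x (k + 1)) to ℝ using
    ⟨(hls.trans_lt (EReal.coe_lt_top _)).ne, ((EReal.bot_lt_coe _).trans_le hlow).ne'⟩ with F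
  rw [EReal.coe_le_coe_iff] at hls hlow
  refine ⟨hlow, hls.trans ?_⟩
  have hγ := h.hγpos (k + 1)
  have hγle := h.hγle (k + 1)
  have hα := (h.hαmem (k + 1)).2
  have hαmax := h.hαmax
  have hcoef : (1 - αmax) / (2 * γmax) ≤ (1 - α (k + 1)) / (2 * γ (k + 1)) :=
    div_le_div₀ (by linarith) (by linarith) (by linarith) (by linarith)
  have := mul_le_mul_of_nonneg_right hcoef (sq_nonneg ‖x (k + 1) - x k‖)
  linarith

/-- The merit values `Φ k` are bounded below by any lower bound of `φ`. -/
lemma NMPG.le_merit {f : X → ℝ} {g : X → EReal} {γmax αmin αmax pmin : ℝ}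
    {x : ℕ → X} {γ α p : ℕ → ℝ} {Φ : ℕ → ℝ}
    (h : NMPG f g γmax αmin αmax pmin x γ α p Φ) {m : ℝ}
    (hm : ∀ z, (m : EReal) ≤ phiE f g z) (k : ℕ) : m ≤ Φ k := by
  induction k with
  | zero => exact EReal.coe_le_coe_iff.1 (h.hΦ0 ▸ hm (x 0))
  | succ k ih =>
    have hF := (h.toReal_bounds hm k).1
    have hp := h.hpmem (k + 1)
    have hpmin := h.hpmin
    rw [h.hΦrec k]
    nlinarith [mul_le_mul_of_nonneg_left ih (sub_nonneg.2 hp.2),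
      mul_le_mul_of_nonneg_left hF (hpmin.le.trans hp.1)]

/-- Sufficient decrease of the merit values. -/
lemma NMPG.merit_decrease {f : X → ℝ} {g : X → EReal} {γmax αmin αmax pmin : ℝ}
    {x : ℕ → X} {γ α p : ℕ → ℝ} {Φ : ℕ → ℝ}
    (h : NMPG f g γmax αmin αmax pmin x γ α p Φ) (k : ℕ) :
    pmin * ((1 - αmax) / (2 * γmax)) * ‖x (k + 1) - x k‖ ^ 2 ≤ Φ k - Φ (k + 1) := by
  obtain ⟨m, hm⟩ := h.hφ_bdd
  have hF := (h.toReal_bounds hm k).2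
  have hp := (h.hpmem (k + 1)).1
  have hc : 0 ≤ (1 - αmax) / (2 * γmax) * ‖x (k + 1) - x k‖ ^ 2 :=
    mul_nonneg (div_nonneg (by linarith [h.hαmax]) (by linarith [h.hγmax])) (sq_nonneg _)
  rw [h.hΦrec k]
  nlinarith [mul_le_mul_of_nonneg_right hp hc,
    mul_le_mul_of_nonneg_left hF (h.hpmin.le.trans hp)]

theorem stmt_4 (f : X → ℝ) (g : X → EReal) (γmax αmin αmax pmin : ℝ)
    (x : ℕ → X) (γ α p : ℕ → ℝ) (Φ : ℕ → ℝ)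
    (h : NMPG f g γmax αmin αmax pmin x γ α p Φ) :
    Tendsto (fun k : ℕ => ‖x (k + 1) - x k‖) atTop (𝓝 0) := by
  obtain ⟨m, hm⟩ := h.hφ_bdd
  set c := pmin * ((1 - αmax) / (2 * γmax)) with hc_def
  have hc : 0 < c :=
    mul_pos h.hpmin (div_pos (by linarith [h.hαmax]) (by linarith [h.hγmax]))
  have hanti : Antitone Φ := antitone_nat_of_succ_le fun k => by
    have := h.merit_decrease k
    have : 0 ≤ c * ‖x (k + 1) - x k‖ ^ 2 := by positivity
    linarith
  have hlim := tendsto_atTop_ciInf hanti ⟨m, Set.forall_mem_range.2 (h.le_merit hm)⟩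
  have hdiff : Tendsto (fun k => (Φ k - Φ (k + 1)) / c) atTop (𝓝 0) := by
    simpa using (hlim.sub (hlim.comp (tendsto_add_atTop_nat 1))).div_const c
  have hsq : Tendsto (fun k => ‖x (k + 1) - x k‖ ^ 2) atTop (𝓝 0) :=
    squeeze_zero (fun k => sq_nonneg _)
      (fun k => (le_div_iff₀' hc).2 (h.merit_decrease k)) hdiff
  simpa using hsq.sqrt
end

section
/- Suppose sequences (x_k), (γ_k), (α_k), (p_k), (Φ_k) are generated by the nonmonotone proximal gradient method with backtracking information. Let x* ∈ X and let k ↦ k_j be a strictly increasing sequence of indices such that x_{k_j} → x* as j → ∞. Then (1/γ_{k_j})·‖x_{k_j} − x_{k_j−1}‖ → 0 as j → ∞. -/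
open Filter Topology
open scoped RealInnerProductSpace

variable {X : Type*} [NormedAddCommGroup X] [InnerProductSpace ℝ X] [FiniteDimensional ℝ X]

theorem ProxMin.ne_top {E : Type*} [NormedAddCommGroup E] [InnerProductSpace ℝ E]
    {g : E → EReal} {v x y z : E} {γ : ℝ}
    (hy : ProxMin g v x γ y) (hz : g z ≠ ⊤) : g y ≠ ⊤ := by
  intro htop
  have h := hy z
  rw [htop, EReal.top_add_coe, top_le_iff] at h
  exact EReal.add_ne_top hz (EReal.coe_ne_top _) h

theorem ProxMin.toReal_le {E : Type*} [NormedAddCommGroup E] [InnerProductSpace ℝ E]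
    {g : E → EReal} {v x y z : E} {γ : ℝ}
    (hbot : ∀ z, g z ≠ ⊥) (hy : ProxMin g v x γ y) (hz : g z ≠ ⊤) :
    (g y).toReal + (⟪v, y - x⟫ + ‖y - x‖ ^ 2 / (2 * γ)) ≤
      (g z).toReal + (⟪v, z - x⟫ + ‖z - x‖ ^ 2 / (2 * γ)) := by
  have h := hy z
  rw [← EReal.coe_toReal (hy.ne_top hz) (hbot y), ← EReal.coe_toReal hz (hbot z)] at h
  exact_mod_cast h

/-- The length of a proximal gradient step is monotone in the stepsize. -/
theorem ProxMin.norm_sub_le {E : Type*} [NormedAddCommGroup E] [InnerProductSpace ℝ E]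
    {g : E → EReal} {v x y y' z : E} {γ σ : ℝ}
    (hbot : ∀ z, g z ≠ ⊥) (hz : g z ≠ ⊤) (hγ : 0 < γ) (hγσ : γ < σ)
    (hy : ProxMin g v x γ y) (hy' : ProxMin g v x σ y') : ‖y - x‖ ≤ ‖y' - x‖ := by
  have h1 := hy.toReal_le hbot (hy'.ne_top hz)
  have h2 := hy'.toReal_le hbot (hy.ne_top hz)
  have h3 : (2 * σ)⁻¹ < (2 * γ)⁻¹ := by gcongr
  simp only [div_eq_mul_inv] at h1 h2
  refine (sq_le_sq₀ (norm_nonneg _) (norm_nonneg _)).1 ?_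
  by_contra! hlt
  nlinarith [mul_pos (sub_pos.2 h3) (sub_pos.2 hlt)]

theorem phiE_eq_coe {E : Type*} {f : E → ℝ} {g : E → EReal} {z : E} (hbot : g z ≠ ⊥) (htop : g z ≠ ⊤) :
    phiE f g z = ((f z + (g z).toReal : ℝ) : EReal) := by
  rw [phiE, EReal.coe_add, EReal.coe_toReal htop hbot]

/-- A uniform first-order expansion of a continuously differentiable function. -/
theorem exists_ball_sub_inner_gradient_le {f : X → ℝ} (hf : ContDiff ℝ 1 f) (a : X) {ε : ℝ}
    (hε : 0 < ε) : ∃ δ > 0, ∀ u v : X, ‖u - a‖ < δ → ‖v - a‖ < δ →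
      f v - f u - ⟪gradient f u, v - u⟫ ≤ ε * ‖v - u‖ := by
  have hstrict : HasStrictFDerivAt f (fderiv ℝ f a) a :=
    hf.contDiffAt.hasStrictFDerivAt one_ne_zero
  have h1 := hstrict.isLittleO.def (half_pos hε)
  have hcont : Continuous (fderiv ℝ f) := hf.continuous_fderiv one_ne_zero
  have h2 : ∀ᶠ u in 𝓝 a, ‖fderiv ℝ f u - fderiv ℝ f a‖ < ε / 2 := by
    have := hcont.tendsto a (Metric.ball_mem_nhds _ (half_pos hε))
    filter_upwards [this] with u hu
    simpa [dist_eq_norm] using hu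
  obtain ⟨δ₁, hδ₁, hb₁⟩ := Metric.eventually_nhds_iff.1 h1
  obtain ⟨δ₂, hδ₂, hb₂⟩ := Metric.eventually_nhds_iff.1 h2
  refine ⟨min δ₁ δ₂, lt_min hδ₁ hδ₂, fun u v hu hv => ?_⟩
  have e1 := hb₁ (y := (v, u)) (by
    rw [Prod.dist_eq, dist_eq_norm, dist_eq_norm]
    exact max_lt (hv.trans_le (min_le_left _ _)) (hu.trans_le (min_le_left _ _)))
  have e2 := hb₂ (y := u) (by rw [dist_eq_norm]; exact hu.trans_le (min_le_right _ _))
  have e3 : ⟪gradient f u, v - u⟫ = fderiv ℝ f u (v - u) := by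
    rw [gradient, InnerProductSpace.toDual_symm_apply]
  have e4 := (fderiv ℝ f u - fderiv ℝ f a).le_of_opNorm_le e2.le (v - u)
  simp only [Real.norm_eq_abs, sub_apply] at e1 e4
  rw [e3]
  linarith [(abs_le.1 e1).2, (abs_le.1 e4).1]

/-- Proximal gradient steps with small stepsizes are short, locally uniformly. -/
theorem exists_stepsize_norm_sub_lt {E : Type*} [NormedAddCommGroup E] [InnerProductSpace ℝ E]
    {g : E → EReal} (hbot : ∀ z, g z ≠ ⊥)
    {γ₀ m : ℝ} (hγ₀ : 0 < γ₀)
    (hm : ∀ z, (m : EReal) ≤ g z + ((‖z‖ ^ 2 / (2 * γ₀) : ℝ) : EReal))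
    (R G C : ℝ) {δ : ℝ} (hδ : 0 < δ) :
    ∃ η > 0, ∀ (v x y : E) (σ : ℝ), 0 < σ → σ < η → ‖x‖ ≤ R → ‖v‖ ≤ G → g x ≠ ⊤ →
      (g x).toReal ≤ C → ProxMin g v x σ y → ‖y - x‖ < δ := by
  set K : ℝ := |C - m| + |G| + (R ^ 2 + 1) / γ₀ with hK
  have hKpos : 0 < K := by positivity
  refine ⟨(2 * (K * (1 / δ ^ 2 + 1)))⁻¹, by positivity, ?_⟩
  intro v x y σ hσ hση hx hv hgx hC hy
  by_contra! hlt
  have h1 := hy.toReal_le hbot hgx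
  have h2 : m ≤ (g y).toReal + ‖y‖ ^ 2 / (2 * γ₀) := by
    have := hm y
    rw [← EReal.coe_toReal (hy.ne_top hgx) (hbot y)] at this
    exact_mod_cast this
  simp only [sub_self, inner_zero_right, norm_zero, ne_eq, OfNat.ofNat_ne_zero,
    not_false_eq_true, zero_pow, zero_div, add_zero] at h1
  set t := ‖y - x‖ with ht
  have h3 : -(G * t) ≤ ⟪v, y - x⟫ := by
    have := (abs_le.1 (abs_real_inner_le_norm v (y - x))).1
    have : ‖v‖ * ‖y - x‖ ≤ G * t := by gcongr
    linarith
  have h4 : ‖y‖ ^ 2 / (2 * γ₀) ≤ (R ^ 2 + t ^ 2) / γ₀ := by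
    have hyn : ‖y‖ ≤ R + t := by
      have := norm_add_le x (y - x)
      rw [add_sub_cancel] at this
      linarith
    have : ‖y‖ ^ 2 ≤ 2 * (R ^ 2 + t ^ 2) := by
      nlinarith [norm_nonneg y, sq_nonneg (R - t)]
    rw [div_le_div_iff₀ (by positivity) hγ₀]
    nlinarith
  have ht0 : 0 < t := hδ.trans_le hlt
  have h5 : G * t ≤ |G| * (1 + t ^ 2) := by
    have : t ≤ 1 + t ^ 2 := by nlinarith [sq_nonneg (t - 1)]
    calc G * t ≤ |G| * t := by gcongr; exact le_abs_self G
      _ ≤ _ := by gcongr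
  have h6 : (R ^ 2 + t ^ 2) / γ₀ ≤ (R ^ 2 + 1) / γ₀ * (1 + t ^ 2) := by
    rw [div_mul_eq_mul_div]
    gcongr
    nlinarith [mul_nonneg (sq_nonneg R) (sq_nonneg t)]
  have h7 : C - m ≤ |C - m| * (1 + t ^ 2) := by
    nlinarith [le_abs_self (C - m), mul_nonneg (abs_nonneg (C - m)) (sq_nonneg t)]
  have h8 : t ^ 2 / (2 * σ) ≤ K * (1 + t ^ 2) := by
    rw [hK, add_mul, add_mul]
    linarith
  have h9 : 1 + t ^ 2 ≤ t ^ 2 * (1 / δ ^ 2 + 1) := by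
    have : 1 ≤ t ^ 2 / δ ^ 2 := by
      rw [one_le_div (by positivity)]
      gcongr
    rw [mul_add, mul_one_div]
    linarith
  have h10 : t ^ 2 / (2 * σ) ≤ t ^ 2 * (K * (1 / δ ^ 2 + 1)) := by
    calc _ ≤ K * (1 + t ^ 2) := h8
      _ ≤ K * (t ^ 2 * (1 / δ ^ 2 + 1)) := by gcongr
      _ = _ := by ring
  rw [div_eq_mul_inv] at h10
  have h11 := le_of_mul_le_mul_left h10 (by positivity)
  have h12 : σ * (2 * (K * (1 / δ ^ 2 + 1))) < 1 := by
    rwa [← lt_div_iff₀ (by positivity), one_div]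
  have h13 : 1 ≤ (K * (1 / δ ^ 2 + 1)) * (2 * σ) := by
    rwa [← div_le_iff₀ (by positivity), one_div]
  linarith

/-- A trial step from `x` that is rejected by a line search is short relative to its stepsize,
as soon as the first-order expansion error of `f` along the step is small. -/
theorem ProxMin.norm_sub_le_of_rejected {f : X → ℝ} {g : X → EReal} {x y : X} {σ a Φ ε : ℝ}
    (hbot : ∀ z, g z ≠ ⊥) (hx : g x ≠ ⊤) (hσ : 0 < σ) (ha : 0 < a)
    (hΦ : f x + (g x).toReal ≤ Φ) (hy : ProxMin g (gradient f x) x σ y)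
    (hrej : ((Φ - (1 - a) / (2 * σ) * ‖y - x‖ ^ 2 : ℝ) : EReal) < phiE f g y)
    (hε : f y - f x - ⟪gradient f x, y - x⟫ ≤ ε * ‖y - x‖) :
    ‖y - x‖ ≤ 2 * ε / a * σ := by
  rw [phiE_eq_coe (hbot y) (hy.ne_top hx), EReal.coe_lt_coe_iff] at hrej
  have h1 := hy.toReal_le hbot hx
  simp only [sub_self, inner_zero_right, norm_zero, ne_eq, OfNat.ofNat_ne_zero,
    not_false_eq_true, zero_pow, zero_div, add_zero] at h1
  set t := ‖y - x‖ with ht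
  have h2 : (1 - a) / (2 * σ) * t ^ 2 = t ^ 2 / (2 * σ) - a * t ^ 2 / (2 * σ) := by ring
  have h3 : a * t ^ 2 / (2 * σ) < ε * t := by linarith
  have ht0 : 0 < t := by
    refine (norm_nonneg _).lt_of_ne fun h0 => ?_
    rw [← ht] at h0
    rw [← h0] at h3
    simp at h3
  rw [div_lt_iff₀ (by positivity)] at h3
  rw [div_mul_eq_mul_div, le_div_iff₀ ha]
  have : t * (t * a) < t * (2 * ε * σ) := by linarith
  exact (lt_of_mul_lt_mul_left this ht0.le).le

namespace NMPG

variable {f : X → ℝ} {g : X → EReal} {γmax αmin αmax pmin : ℝ}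
  {x : ℕ → X} {γ α p : ℕ → ℝ} {Φ : ℕ → ℝ}

theorem g_ne_top (h : NMPG f g γmax αmin αmax pmin x γ α p Φ) (k : ℕ) : g (x k) ≠ ⊤ := by
  cases k with
  | zero => exact h.hx0
  | succ k =>
    obtain ⟨z, hz⟩ := h.hg_proper
    exact (h.hstep k).ne_top hz

theorem phiE_eq (h : NMPG f g γmax αmin αmax pmin x γ α p Φ) (k : ℕ) :
    phiE f g (x k) = ((f (x k) + (g (x k)).toReal : ℝ) : EReal) :=
  phiE_eq_coe (h.hg_nebot _) (h.g_ne_top k)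

theorem line_search (h : NMPG f g γmax αmin αmax pmin x γ α p Φ) (k : ℕ) :
    f (x (k + 1)) + (g (x (k + 1))).toReal ≤
      Φ k - (1 - α (k + 1)) / (2 * γ (k + 1)) * ‖x (k + 1) - x k‖ ^ 2 := by
  have := h.hls k
  rwa [h.phiE_eq, EReal.coe_le_coe_iff] at this

theorem decrease_nonneg (h : NMPG f g γmax αmin αmax pmin x γ α p Φ) (k : ℕ) :
    0 ≤ (1 - α (k + 1)) / (2 * γ (k + 1)) * ‖x (k + 1) - x k‖ ^ 2 := by
  have h1 := h.hγpos (k + 1)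
  have h2 : 0 ≤ 1 - α (k + 1) := by linarith [(h.hαmem (k + 1)).2, h.hαmax]
  positivity

theorem recurrence (h : NMPG f g γmax αmin αmax pmin x γ α p Φ) (k : ℕ) :
    Φ (k + 1) = (1 - p (k + 1)) * Φ k + p (k + 1) * (f (x (k + 1)) + (g (x (k + 1))).toReal) := by
  rw [h.hΦrec, h.phiE_eq, EReal.toReal_coe]

theorem objective_le (h : NMPG f g γmax αmin αmax pmin x γ α p Φ) (k : ℕ) :
    f (x k) + (g (x k)).toReal ≤ Φ k := by
  cases k with
  | zero =>
    have := h.hΦ0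
    rw [h.phiE_eq, EReal.coe_eq_coe_iff] at this
    exact this.ge
  | succ k =>
    rw [h.recurrence]
    nlinarith [h.line_search k, h.decrease_nonneg k, (h.hpmem (k + 1)).2]

theorem succ_le (h : NMPG f g γmax αmin αmax pmin x γ α p Φ) (k : ℕ) :
    Φ (k + 1) ≤ Φ k - pmin * ((1 - αmax) / (2 * γmax) * ‖x (k + 1) - x k‖ ^ 2) := by
  have hγ := h.hγpos (k + 1)
  have hα : (1 - αmax) / (2 * γmax) * ‖x (k + 1) - x k‖ ^ 2 ≤
      (1 - α (k + 1)) / (2 * γ (k + 1)) * ‖x (k + 1) - x k‖ ^ 2 := by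
    have h1 := (h.hαmem (k + 1)).2
    have h2 := h.hγle (k + 1)
    have h3 := h.hαmax
    gcongr
    linarith
  have hp := h.hpmem (k + 1)
  have hp0 := h.hpmin
  have h4 := h.decrease_nonneg k
  have h5 := h.line_search k
  rw [h.recurrence]
  calc _ = Φ k - p (k + 1) * (Φ k - (f (x (k + 1)) + (g (x (k + 1))).toReal)) := by ring
    _ ≤ Φ k - pmin * ((1 - α (k + 1)) / (2 * γ (k + 1)) * ‖x (k + 1) - x k‖ ^ 2) := by
      gcongr
      · exact hp0.le.trans hp.1
      · exact hp.1
      · linarith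
    _ ≤ _ := by gcongr

theorem antitone (h : NMPG f g γmax αmin αmax pmin x γ α p Φ) : Antitone Φ := by
  refine antitone_nat_of_succ_le fun k => (h.succ_le k).trans ?_
  have h1 := h.hpmin
  have h2 := h.hγmax
  have h3 : 0 < 1 - αmax := by linarith [h.hαmax]
  have : 0 ≤ pmin * ((1 - αmax) / (2 * γmax) * ‖x (k + 1) - x k‖ ^ 2) := by positivity
  linarith

theorem tendsto_norm_sub (h : NMPG f g γmax αmin αmax pmin x γ α p Φ) :
    Tendsto (fun k => ‖x (k + 1) - x k‖) atTop (𝓝 0) := by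
  have hbdd : BddBelow (Set.range Φ) := by
    obtain ⟨m, hm⟩ := h.hφ_bdd
    refine ⟨m, ?_⟩
    rintro _ ⟨k, rfl⟩
    have := hm (x k)
    rw [h.phiE_eq, EReal.coe_le_coe_iff] at this
    exact this.trans (h.objective_le k)
  have hlim := tendsto_atTop_ciInf h.antitone hbdd
  have hdiff : Tendsto (fun k => Φ k - Φ (k + 1)) atTop (𝓝 0) := by
    simpa using hlim.sub (hlim.comp (tendsto_add_atTop_nat 1))
  set c := pmin * ((1 - αmax) / (2 * γmax)) with hc
  have hcpos : 0 < c := by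
    have h1 := h.hpmin
    have h2 := h.hγmax
    have h3 : 0 < 1 - αmax := by linarith [h.hαmax]
    positivity
  have hsq : Tendsto (fun k => ‖x (k + 1) - x k‖ ^ 2) atTop (𝓝 0) := by
    refine squeeze_zero (fun k => sq_nonneg _) (fun k => ?_) (by simpa using hdiff.div_const c)
    rw [le_div_iff₀ hcpos]
    linarith [h.succ_le k]
  have := hsq.sqrt
  simpa [Real.sqrt_sq (norm_nonneg _)] using this

end NMPG

theorem stmt_5 (f : X → ℝ) (g : X → EReal) (γmax αmin αmax pmin : ℝ)
    (x : ℕ → X) (γ α p : ℕ → ℝ) (Φ : ℕ → ℝ)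
    (h : NMPG f g γmax αmin αmax pmin x γ α p Φ)
    (γmin βmin βmax : ℝ) (hγmin : 0 < γmin) (hβmin : 0 < βmin)
    (hββ : βmin ≤ βmax) (hβmax : βmax < 1)
    (hbt : Backtrack f g αmin γmin βmin βmax x γ Φ)
    (xstar : X) (ks : ℕ → ℕ) (hks : StrictMono ks)
    (hconv : Tendsto (fun j => x (ks j)) atTop (𝓝 xstar)) :
    Tendsto (fun j => 1 / γ (ks j) * ‖x (ks j) - x (ks j - 1)‖) atTop (𝓝 0) := by
  rw [← tendsto_add_atTop_iff_nat 1]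
  obtain ⟨ls, hls⟩ : ∃ ls : ℕ → ℕ, ∀ j, ks (j + 1) = ls j + 1 :=
    ⟨fun j => ks (j + 1) - 1, fun j => (Nat.sub_add_cancel
      ((Nat.succ_le_succ (Nat.zero_le j)).trans (hks.id_le (j + 1)))).symm⟩
  simp only [hls, Nat.add_sub_cancel]
  have hls_top : Tendsto ls atTop atTop := by
    refine tendsto_atTop_mono (fun j => ?_) tendsto_id
    have := hks.id_le (j + 1)
    rw [hls] at this
    exact Nat.le_of_succ_le_succ this
  have hd : Tendsto (fun j => ‖x (ls j + 1) - x (ls j)‖) atTop (𝓝 0) :=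
    h.tendsto_norm_sub.comp hls_top
  have hconv' : Tendsto (fun j => x (ls j + 1)) atTop (𝓝 xstar) := by
    simpa only [Function.comp_def, hls] using hconv.comp (tendsto_add_atTop_nat 1)
  have hx : Tendsto (fun j => x (ls j)) atTop (𝓝 xstar) := by
    simpa using hconv'.sub (tendsto_zero_iff_norm_tendsto_zero.2 hd)
  have hgrad : Continuous (gradient f) :=
    (InnerProductSpace.toDual ℝ X).symm.continuous.comp (h.hf.continuous_fderiv one_ne_zero)
  have hβmax0 : 0 < βmax := hβmin.trans_le hββ
  have hαmin := h.hαmin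
  obtain ⟨γ₀, hγ₀, m, hm⟩ := h.hg_proxbdd
  rw [Metric.tendsto_atTop']
  intro ε hε
  set ε' := ε * βmin * αmin / 4 with hε'
  obtain ⟨δ, hδ, hexp⟩ := exists_ball_sub_inner_gradient_le h.hf xstar (ε := ε') (by positivity)
  obtain ⟨η, hη, hshort⟩ := exists_stepsize_norm_sub_lt h.hg_nebot hγ₀ hm (‖xstar‖ + 1)
    (‖gradient f xstar‖ + 1) (Φ 0 - f xstar + 1) (half_pos hδ)
  set θ := min γmin (η * βmin) with hθ
  have hθ0 : 0 < θ := lt_min hγmin (by positivity)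
  have hev : ∀ᶠ j in atTop, ‖1 / γ (ls j + 1) * ‖x (ls j + 1) - x (ls j)‖‖ < ε := by
    filter_upwards [hd.eventually_lt_const (show 0 < ε * θ by positivity),
      (tendsto_iff_norm_sub_tendsto_zero.1 hx).eventually_lt_const (half_pos hδ),
      hx.norm.eventually_le_const (lt_add_one _),
      ((hgrad.tendsto _).comp hx).norm.eventually_le_const (lt_add_one _),
      ((h.hf.continuous.tendsto _).comp hx).eventually_const_le (sub_one_lt _)]
      with j hj1 hj2 hj3 hj4 hj5
    set k := ls j
    have hγ := h.hγpos (k + 1)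
    rw [Real.norm_of_nonneg (by positivity), one_div_mul_eq_div, div_lt_iff₀ hγ]
    rcases le_or_gt θ (γ (k + 1)) with hle | hlt
    · exact hj1.trans_le (by gcongr)
    obtain hge | ⟨σ, y, hσ1, hσ2, hy, hrej⟩ := hbt k
    · exact absurd (hlt.trans_le (min_le_left _ _)) hge.not_gt
    have hγσ : γ (k + 1) < σ := by
      refine lt_of_lt_of_le ?_ hσ1
      rw [lt_div_iff₀ hβmax0]
      nlinarith
    have hσ0 : 0 < σ := hγ.trans hγσ
    have hση : σ < η := by
      refine hσ2.trans_lt ?_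
      rw [div_lt_iff₀ hβmin]
      exact hlt.trans_le (min_le_right _ _)
    have hgx := h.g_ne_top k
    have hobj := h.objective_le k
    have hyx : ‖y - x k‖ < δ / 2 := by
      refine hshort _ _ _ _ hσ0 hση hj3 hj4 hgx ?_ hy
      have := h.antitone (Nat.zero_le k)
      simp only [Function.comp_apply] at hj5
      linarith
    have hystar : ‖y - xstar‖ < δ := by
      have := norm_add_le (y - x k) (x k - xstar)
      rw [sub_add_sub_cancel] at this
      linarith
    have hrate := hy.norm_sub_le_of_rejected h.hg_nebot hgx hσ0 hαmin hobj hrej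
      (hexp (x k) y (by linarith) hystar)
    have hmono := ProxMin.norm_sub_le h.hg_nebot hgx hγ hγσ (h.hstep k) hy
    calc ‖x (k + 1) - x k‖ ≤ 2 * ε' / αmin * σ := hmono.trans hrate
      _ ≤ 2 * ε' / αmin * (γ (k + 1) / βmin) := by gcongr
      _ = ε / 2 * γ (k + 1) := by rw [hε']; field_simp; ring
      _ < ε * γ (k + 1) := by gcongr; linarith
  obtain ⟨N, hN⟩ := eventually_atTop.1 hev
  exact ⟨N, fun j hj => by simpa [dist_eq_norm] using hN j hj.le⟩
end

section
/- Suppose sequences (x_k), (γ_k), (α_k), (p_k), (Φ_k) are generated by the nonmonotone proximal gradient method. Then for every k ≥ 1, min_{1≤j≤k} ‖x_j − x_{j−1}‖ ≤ (1/√k)·( 2γ_max·(φ(x_0) − φ_*) / (p_min·(1 − α_max)) )^{1/2}, where φ_* denotes the (existing, finite) limit of the nonincreasing sequence (Φ_k). -/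
open Filter Topology
open scoped RealInnerProductSpace

variable {X : Type*} [NormedAddCommGroup X] [InnerProductSpace ℝ X] [FiniteDimensional ℝ X]

namespace NMPG

variable {f : X → ℝ} {g : X → EReal} {γmax αmin αmax pmin : ℝ}
  {x : ℕ → X} {γ α p : ℕ → ℝ} {Φ : ℕ → ℝ}

/-- The line search condition as an inequality between real numbers. -/
theorem toReal_phiE_le (h : NMPG f g γmax αmin αmax pmin x γ α p Φ) (k : ℕ) :
    (phiE f g (x (k + 1))).toReal ≤
      Φ k - (1 - α (k + 1)) / (2 * γ (k + 1)) * ‖x (k + 1) - x k‖ ^ 2 := by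
  obtain ⟨m, hm⟩ := h.hφ_bdd
  have hbot : phiE f g (x (k + 1)) ≠ ⊥ := ((EReal.bot_lt_coe m).trans_le (hm _)).ne'
  exact EReal.toReal_le_toReal (h.hls k) hbot (EReal.coe_ne_top _)

/-- Sufficient decrease of the merit values `Φ`. -/
theorem sufficient_decrease (h : NMPG f g γmax αmin αmax pmin x γ α p Φ) (k : ℕ) :
    pmin * (1 - αmax) / (2 * γmax) * ‖x (k + 1) - x k‖ ^ 2 ≤ Φ k - Φ (k + 1) := by
  have hγ := h.hγpos (k + 1)
  have hp := h.hpmem (k + 1)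
  have hα := h.hαmem (k + 1)
  have hp0 : 0 ≤ p (k + 1) := h.hpmin.le.trans hp.1
  have hα0 : 0 ≤ 1 - αmax := by linarith [h.hαmax]
  have hcoef : pmin * (1 - αmax) / (2 * γmax) ≤
      p (k + 1) * (1 - α (k + 1)) / (2 * γ (k + 1)) := by
    gcongr
    · exact mul_nonneg hp0 (by linarith [hα.2])
    · exact hp.1
    · exact hα.2
    · exact h.hγle (k + 1)
  calc pmin * (1 - αmax) / (2 * γmax) * ‖x (k + 1) - x k‖ ^ 2
      ≤ p (k + 1) * (1 - α (k + 1)) / (2 * γ (k + 1)) * ‖x (k + 1) - x k‖ ^ 2 := by gcongr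
    _ = p (k + 1) * ((1 - α (k + 1)) / (2 * γ (k + 1)) * ‖x (k + 1) - x k‖ ^ 2) := by ring
    _ ≤ p (k + 1) * (Φ k - (phiE f g (x (k + 1))).toReal) := by
        gcongr
        linarith [h.toReal_phiE_le k]
    _ = Φ k - Φ (k + 1) := by rw [h.hΦrec k]; ring

theorem sum_sq_le (h : NMPG f g γmax αmin αmax pmin x γ α p Φ) (k : ℕ) :
    pmin * (1 - αmax) / (2 * γmax) * ∑ i ∈ Finset.range k, ‖x (i + 1) - x i‖ ^ 2 ≤
      Φ 0 - Φ k := by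
  rw [Finset.mul_sum, ← Finset.sum_range_sub']
  exact Finset.sum_le_sum fun i _ => h.sufficient_decrease i

theorem merit_zero_s11 (h : NMPG f g γmax αmin αmax pmin x γ α p Φ) :
    Φ 0 = f (x 0) + (g (x 0)).toReal := by
  have h0 := h.hΦ0
  rw [phiE, ← EReal.coe_toReal h.hx0 (h.hg_nebot _)] at h0
  exact_mod_cast h0

end NMPG

theorem stmt_11 (f : X → ℝ) (g : X → EReal) (γmax αmin αmax pmin : ℝ)
    (x : ℕ → X) (γ α p : ℕ → ℝ) (Φ : ℕ → ℝ)
    (h : NMPG f g γmax αmin αmax pmin x γ α p Φ)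
    (φstar : ℝ) (hΦlim : Tendsto Φ atTop (𝓝 φstar))
    (k : ℕ) (hk : 1 ≤ k) :
    (Finset.Icc 1 k).inf' (Finset.nonempty_Icc.mpr hk) (fun j => ‖x j - x (j - 1)‖) ≤
      1 / Real.sqrt k *
        Real.sqrt (2 * γmax * (f (x 0) + (g (x 0)).toReal - φstar) / (pmin * (1 - αmax))) := by
  set d := (Finset.Icc 1 k).inf' (Finset.nonempty_Icc.mpr hk) (fun j => ‖x j - x (j - 1)‖)
  have hd0 : 0 ≤ d := Finset.le_inf' _ _ fun j _ => norm_nonneg _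
  have hdle : ∀ i ∈ Finset.range k, d ^ 2 ≤ ‖x (i + 1) - x i‖ ^ 2 := fun i hi => by
    have hdi : d ≤ ‖x (i + 1) - x (i + 1 - 1)‖ :=
      Finset.inf'_le (fun j => ‖x j - x (j - 1)‖)
        (Finset.mem_Icc.mpr ⟨by omega, Finset.mem_range.mp hi⟩)
    rw [Nat.add_sub_cancel] at hdi
    gcongr
  have hsum : k * d ^ 2 ≤ ∑ i ∈ Finset.range k, ‖x (i + 1) - x i‖ ^ 2 := by
    simpa using Finset.card_nsmul_le_sum _ _ _ hdle
  have hγmax := h.hγmax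
  have hc : 0 < pmin * (1 - αmax) := mul_pos h.hpmin (by linarith [h.hαmax])
  have hk0 : (0 : ℝ) < k := by exact_mod_cast hk
  have hbound : pmin * (1 - αmax) / (2 * γmax) * (k * d ^ 2) ≤ Φ 0 - φstar :=
    calc pmin * (1 - αmax) / (2 * γmax) * (k * d ^ 2)
        ≤ pmin * (1 - αmax) / (2 * γmax) * ∑ i ∈ Finset.range k, ‖x (i + 1) - x i‖ ^ 2 := by
          gcongr
      _ ≤ Φ 0 - Φ k := h.sum_sq_le k
      _ ≤ Φ 0 - φstar := by linarith [h.antitone.le_of_tendsto hΦlim k]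
  rw [← h.merit_zero_s11, one_div, ← Real.sqrt_inv, ← Real.sqrt_mul (by positivity)]
  refine Real.le_sqrt_of_sq_le ?_
  rw [inv_mul_eq_div, le_div_iff₀ hk0, le_div_iff₀ hc]
  rw [div_mul_eq_mul_div, div_le_iff₀ (by positivity)] at hbound
  linarith
end
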